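/- arXiv:2101.00161 — 2 statements merged into one kernel-verified Lean document; each statement's English description precedes it below -/
import Mathlib

section
/- Consider the output-coupled heterogeneous network ż_i = g_i(t, z_i, y_i) ∈ ℝ^{m_i}, ẏ_i = h_i(t, y_i, z_i) + k·Λ·Σ_{j∈N_i} α_{ij}(y_j − y_i) ∈ ℝ^n, i = 1,…,N, over an undirected connected weighted graph with Λ symmetric positive definite, and its blended dynamics ẑ̇_i = g_i(t, ẑ_i, s), ṡ = (1/N)·Σ_{i=1}^N h_i(t, s, ẑ_i). Assume there is a nonempty compact set 𝒜_b that is uniformly asymptotically stable for the blended dynamics, with an open set 𝒟_b ⊇ 𝒜_b contained in its domain of attraction. Define 𝒜_x := {col(ẑ_1, s, ẑ_2, s, …, ẑ_N, s) : col(ẑ_1,…,ẑ_N, s) ∈ 𝒜_b} and 𝒟_x := {col(ẑ_1, s_1, …, ẑ_N, s_N) : there exists s with col(ẑ_1,…,ẑ_N, s) ∈ 𝒟_b and (1/N)·Σ_{i=1}^N s_i = s}. Then for every compact set K ⊂ 𝒟_x and every η > 0 there exists k* > 0 such that for every k > k* and every initial condition (z_1(t₀), y_1(t₀), …, z_N(t₀),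 y_N(t₀)) ∈ K, the solution of the network exists for all t ≥ t₀ and satisfies limsup_{t→∞} dist(col(z_1(t), y_1(t), …, z_N(t), y_N(t)), 𝒜_x) ≤ η. -/
open Filter Matrix

/-- Euclidean norm of a finitely-indexed real vector. -/
noncomputable def eunorm {ι : Type*} [Fintype ι] (v : ι → ℝ) : ℝ :=
  Real.sqrt (∑ j, v j ^ 2)

/-- Euclidean distance from a point to a set. -/
noncomputable def einfDist {ι : Type*} [Fintype ι] (x : ι → ℝ) (A : Set (ι → ℝ)) : ℝ :=
  ⨅ a : A, eunorm (x - (a : ι → ℝ))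

/-- `limsup_{t→∞} g(t) ≤ c`. -/
def LimsupLE (g : ℝ → ℝ) (c : ℝ) : Prop :=
  ∀ ε > 0, ∃ T : ℝ, ∀ t ≥ T, g t ≤ c + ε

/-- Laplacian matrix `𝓛 = D - A` of the weighted graph with weights `α`. -/
noncomputable def lapMat {N : ℕ} (α : Fin N → Fin N → ℝ) : Matrix (Fin N) (Fin N) ℝ :=
  Matrix.of fun i j => (if i = j then ∑ l, α i l else 0) - α i j

/-- Regularity of a time-varying vector field with two state arguments. -/
def Reg2 {d₁ d₂ d₃ : ℕ} (g : ℝ → (Fin d₁ → ℝ) → (Fin d₂ → ℝ) → Fin d₃ → ℝ) : Prop :=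
  Continuous (fun p : ℝ × (Fin d₁ → ℝ) × (Fin d₂ → ℝ) => g p.1 p.2.1 p.2.2) ∧
  (∀ t, ContDiff ℝ 1 (fun p : (Fin d₁ → ℝ) × (Fin d₂ → ℝ) => g t p.1 p.2)) ∧
  (∀ p₀ : (Fin d₁ → ℝ) × (Fin d₂ → ℝ), ∃ L : NNReal, ∃ ε > 0, ∀ t,
    LipschitzOnWith L (fun p : (Fin d₁ → ℝ) × (Fin d₂ → ℝ) => g t p.1 p.2) (Metric.ball p₀ ε)) ∧
  (∃ C : ℝ, ∀ t, eunorm (g t 0 0) ≤ C)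

/-- `x` is a solution of `ẋ = F(t,x)` on `[t₀,∞)`. -/
def IsSolOn {ι : Type*} [Fintype ι] (F : ℝ → (ι → ℝ) → ι → ℝ)
    (x : ℝ → ι → ℝ) (t₀ : ℝ) : Prop :=
  ∀ t ≥ t₀, HasDerivAt x (F t (x t)) t

/-- Uniform asymptotic stability of the compact set `A` for `ẋ = F(t,x)`, with
the open set `D ⊇ A` contained in its domain of attraction. -/
def UAS {ι : Type*} [Fintype ι] (F : ℝ → (ι → ℝ) → ι → ℝ)
    (A D : Set (ι → ℝ)) : Prop :=
  (∀ ε > 0, ∃ δ > 0, ∀ (t₀ : ℝ) (x : ℝ → ι → ℝ), IsSolOn F x t₀ →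
      einfDist (x t₀) A < δ → ∀ t ≥ t₀, einfDist (x t) A < ε) ∧
  (∀ C : Set (ι → ℝ), IsCompact C → C ⊆ D →
    (∀ (t₀ : ℝ), ∀ x₀ ∈ C, ∃ x : ℝ → ι → ℝ, x t₀ = x₀ ∧ IsSolOn F x t₀) ∧
    (∀ ε > 0, ∃ T > 0, ∀ (t₀ : ℝ) (x : ℝ → ι → ℝ), IsSolOn F x t₀ → x t₀ ∈ C →
      ∀ t ≥ t₀ + T, einfDist (x t) A < ε))

/-- The combined vector field of the blended dynamics
`ẑ̇ᵢ = gᵢ(t, ẑᵢ, s)`, `ṡ = (1/N) Σᵢ hᵢ(t, s, ẑᵢ)`. -/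
noncomputable def blendField {N n : ℕ} {m : Fin N → ℕ}
    (g : (i : Fin N) → ℝ → (Fin (m i) → ℝ) → (Fin n → ℝ) → Fin (m i) → ℝ)
    (h : (i : Fin N) → ℝ → (Fin n → ℝ) → (Fin (m i) → ℝ) → Fin n → ℝ)
    (t : ℝ) (p : ((Σ i : Fin N, Fin (m i)) ⊕ Fin n) → ℝ) :
    ((Σ i : Fin N, Fin (m i)) ⊕ Fin n) → ℝ :=
  Sum.elim
    (fun q : Σ i : Fin N, Fin (m i) =>
      g q.1 t (fun b => p (Sum.inl ⟨q.1, b⟩)) (fun j => p (Sum.inr j)) q.2)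
    (fun j : Fin n =>
      ((N : ℝ)⁻¹ • ∑ i, h i t (fun j' => p (Sum.inr j')) (fun b => p (Sum.inl ⟨i, b⟩))) j)


/-- coordinatewise clamp -/
noncomputable def clampV {d : ℕ} (R : ℝ) (x : Fin d → ℝ) : Fin d → ℝ :=
  fun i => max (-R) (min R (x i))

lemma clampV_lip {d : ℕ} (R : ℝ) (x y : Fin d → ℝ) :
    ‖clampV R x - clampV R y‖ ≤ ‖x - y‖ := by
  rw [pi_norm_le_iff_of_nonneg (norm_nonneg _)]
  intro i
  refine le_trans ?_ (norm_le_pi_norm (x - y) i)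
  simp only [clampV, Pi.sub_apply, Real.norm_eq_abs]
  have h1 := abs_max_sub_max_le_max (-R) (min R (x i)) (-R) (min R (y i))
  have h2 := abs_min_sub_min_le_max R (x i) R (y i)
  simp only [sub_self, abs_zero] at h1 h2
  have h3 : max 0 |min R (x i) - min R (y i)| = _ := max_eq_right (abs_nonneg _)
  have h4 : max 0 |x i - y i| = _ := max_eq_right (abs_nonneg _)
  rw [h3] at h1
  rw [h4] at h2
  linarith

lemma clampV_norm {d : ℕ} {R : ℝ} (hR : 0 ≤ R) (x : Fin d → ℝ) : ‖clampV R x‖ ≤ R := by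
  rw [pi_norm_le_iff_of_nonneg hR]
  intro i
  simp only [clampV, Real.norm_eq_abs, abs_le]
  exact ⟨le_max_left _ _, max_le (by linarith) (min_le_left _ _)⟩

lemma clampV_eq {d : ℕ} {R : ℝ} {x : Fin d → ℝ} (hx : ‖x‖ ≤ R) : clampV R x = x := by
  funext i
  have := (norm_le_pi_norm x i).trans hx
  rw [Real.norm_eq_abs, abs_le] at this
  simp only [clampV]
  rw [min_eq_right this.2, max_eq_right this.1]

lemma clampV_cont {d : ℕ} (R : ℝ) : Continuous (clampV R : (Fin d → ℝ) → Fin d → ℝ) := by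
  unfold clampV; fun_prop

lemma norm_le_eunorm {ι : Type*} [Fintype ι] (v : ι → ℝ) : ‖v‖ ≤ eunorm v := by
  unfold eunorm
  rw [pi_norm_le_iff_of_nonneg (Real.sqrt_nonneg _)]
  intro i
  rw [Real.norm_eq_abs]
  refine Real.abs_le_sqrt ?_
  exact Finset.single_le_sum (f := fun j => v j ^ 2) (fun j _ => sq_nonneg _) (Finset.mem_univ i)

lemma eunorm_le_norm {ι : Type*} [Fintype ι] (v : ι → ℝ) :
    eunorm v ≤ (Fintype.card ι + 1) * ‖v‖ := by
  unfold eunorm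
  rw [Real.sqrt_le_left (by positivity)]
  have : ∀ j, v j ^ 2 ≤ ‖v‖ ^ 2 := fun j => by
    have := norm_le_pi_norm v j
    rw [Real.norm_eq_abs] at this
    exact sq_le_sq' (by linarith [neg_abs_le (v j)]) (by linarith [le_abs_self (v j)])
  calc ∑ j, v j ^ 2 ≤ ∑ j : ι, ‖v‖ ^ 2 := Finset.sum_le_sum fun j _ => this j
    _ = Fintype.card ι * ‖v‖ ^ 2 := by simp
    _ ≤ ((Fintype.card ι + 1) * ‖v‖) ^ 2 := by
      rw [mul_pow]
      gcongr
      have : (0:ℝ) ≤ Fintype.card ι := Nat.cast_nonneg _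
      nlinarith

lemma einfDist_lt {ι : Type*} [Fintype ι] {x : ι → ℝ} {A : Set (ι → ℝ)} (hA : A.Nonempty)
    {ε : ℝ} (h : einfDist x A < ε) : ∃ a ∈ A, ‖x - a‖ < ε := by
  have := hA.to_subtype
  obtain ⟨a, ha⟩ := exists_lt_of_ciInf_lt h
  exact ⟨a, a.2, (norm_le_eunorm _).trans_lt ha⟩

lemma einfDist_le {ι : Type*} [Fintype ι] {x a : ι → ℝ} {A : Set (ι → ℝ)} (ha : a ∈ A) :
    einfDist x A ≤ (Fintype.card ι + 1) * ‖x - a‖ := by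
  refine le_trans ?_ (eunorm_le_norm _)
  exact ciInf_le (f := fun a : A => eunorm (x - (a : ι → ℝ)))
    ⟨0, by rintro _ ⟨b, rfl⟩; exact Real.sqrt_nonneg _⟩ ⟨a, ha⟩

lemma reg2_clamp {d₁ d₂ d₃ : ℕ} {g : ℝ → (Fin d₁ → ℝ) → (Fin d₂ → ℝ) → Fin d₃ → ℝ}
    (hg : Reg2 g) {R : ℝ} (hR : 0 ≤ R) :
    ∃ (g' : ℝ → (Fin d₁ → ℝ) → (Fin d₂ → ℝ) → Fin d₃ → ℝ) (L : ℝ), 0 ≤ L ∧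
      Continuous (fun p : ℝ × (Fin d₁ → ℝ) × (Fin d₂ → ℝ) => g' p.1 p.2.1 p.2.2) ∧
      (∀ t p q p' q', ‖g' t p q - g' t p' q'‖ ≤ L * max ‖p - p'‖ ‖q - q'‖) ∧
      (∀ t p q, ‖g' t p q‖ ≤ L) ∧
      (∀ t p q, ‖p‖ ≤ R → ‖q‖ ≤ R → g' t p q = g t p q) := by
  obtain ⟨hc, hd, hl, C, hC⟩ := hg
  have key : ∃ L : ℝ, ∀ p ∈ Metric.closedBall (0 : (Fin d₁ → ℝ) × (Fin d₂ → ℝ)) R, ∀ t,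
      ‖fderiv ℝ (fun p : (Fin d₁ → ℝ) × (Fin d₂ → ℝ) => g t p.1 p.2) p‖ ≤ L := by
    refine (isCompact_closedBall (0 : (Fin d₁ → ℝ) × (Fin d₂ → ℝ)) R).induction_on
      (p := fun S => ∃ L : ℝ, ∀ p ∈ S, ∀ t,
      ‖fderiv ℝ (fun p : (Fin d₁ → ℝ) × (Fin d₂ → ℝ) => g t p.1 p.2) p‖ ≤ L) ?_ ?_ ?_ ?_
    · exact ⟨0, by simp⟩
    · rintro s t hst ⟨L, h⟩
      exact ⟨L, fun p hp => h p (hst hp)⟩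
    · rintro s t ⟨L, h⟩ ⟨L', h'⟩
      refine ⟨max L L', ?_⟩
      rintro p (hp | hp) τ
      · exact (h p hp τ).trans (le_max_left _ _)
      · exact (h' p hp τ).trans (le_max_right _ _)
    · intro p₀ _
      obtain ⟨L, ε, hε, h⟩ := hl p₀
      refine ⟨Metric.ball p₀ ε, mem_nhdsWithin_of_mem_nhds (Metric.ball_mem_nhds _ hε), L, ?_⟩
      intro p hp t
      exact norm_fderiv_le_of_lipschitzOn ℝ (Metric.isOpen_ball.mem_nhds hp) (h t)
  obtain ⟨L, hL⟩ := key
  have hL0 : 0 ≤ L := (norm_nonneg _).trans (hL 0 (by simpa using hR) 0)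
  have hlip : ∀ t p q p' q', ‖p‖ ≤ R → ‖q‖ ≤ R → ‖p'‖ ≤ R → ‖q'‖ ≤ R →
      ‖g t p q - g t p' q'‖ ≤ L * max ‖p - p'‖ ‖q - q'‖ := by
    intro t p q p' q' h1 h2 h3 h4
    have := (convex_closedBall (0 : (Fin d₁ → ℝ) × (Fin d₂ → ℝ)) R).norm_image_sub_le_of_norm_fderiv_le
      (𝕜 := ℝ) (f := fun p : (Fin d₁ → ℝ) × (Fin d₂ → ℝ) => g t p.1 p.2) (C := L)
      (x := (p', q')) (y := (p, q))
      (fun x _ => ((hd t).differentiable one_ne_zero) x) (fun x hx => hL x hx t)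
      (by simp [h3, h4]) (by simp [h1, h2])
    simpa [Prod.norm_def] using this
  have hCn : ∀ t, ‖g t 0 0‖ ≤ C := fun t => (norm_le_eunorm _).trans (hC t)
  have hC0 : 0 ≤ C := (norm_nonneg _).trans (hCn 0)
  refine ⟨fun t p q => g t (clampV R p) (clampV R q), L + C + L * R, by positivity, ?_, ?_, ?_, ?_⟩
  · exact hc.comp (continuous_fst.prodMk (((clampV_cont R).comp (continuous_fst.comp continuous_snd)).prodMk
      ((clampV_cont R).comp (continuous_snd.comp continuous_snd))))
  · intro t p q p' q'
    refine (hlip t _ _ _ _ (clampV_norm hR _) (clampV_norm hR _) (clampV_norm hR _) (clampV_norm hR _)).trans ?_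
    have : 0 ≤ L * R := by positivity
    gcongr
    · linarith
    · exact clampV_lip _ _ _
    · exact clampV_lip _ _ _
  · intro t p q
    have := hlip t (clampV R p) (clampV R q) 0 0 (clampV_norm hR _) (clampV_norm hR _) (by simpa) (by simpa)
    have h2 : L * max ‖clampV R p - 0‖ ‖clampV R q - 0‖ ≤ L * R := by
      gcongr
      simp [clampV_norm hR]
    have h3 := norm_le_norm_sub_add (g t (clampV R p) (clampV R q)) (g t 0 0)
    have h4 := hCn t
    show ‖g t (clampV R p) (clampV R q)‖ ≤ _
    linarith
  · intro t p q hp hq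
    simp only [clampV_eq hp, clampV_eq hq]

lemma local_exists {E : Type*} [NormedAddCommGroup E] [NormedSpace ℝ E] [CompleteSpace E]
    (F : ℝ → E → E) (K : NNReal) (hL : ∀ t, LipschitzWith K (F t))
    (hc : ∀ x, Continuous (fun t => F t x)) (τ : ℝ) (hτ : 0 < τ) (hKτ : K * τ ≤ 1 / 2)
    (t₀ : ℝ) (x₀ : E) :
    ∃ x : ℝ → E, x t₀ = x₀ ∧ ∀ t ∈ Set.Ioo (t₀ - τ) (t₀ + τ), HasDerivAt x (F t (x t)) t := by
  obtain ⟨c, hcb⟩ := (isCompact_Icc (a := t₀ - τ) (b := t₀ + τ)).exists_bound_of_continuousOn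
    (hc x₀).continuousOn
  have hc0 : 0 ≤ c := (norm_nonneg _).trans (hcb t₀ ⟨by linarith, by linarith⟩)
  obtain ⟨c', hc'⟩ : ∃ c' : NNReal, (c' : ℝ) = c := ⟨⟨c, hc0⟩, rfl⟩
  obtain ⟨τ', hτ'⟩ : ∃ c' : NNReal, (c' : ℝ) = τ := ⟨⟨τ, hτ.le⟩, rfl⟩
  have hPL : IsPicardLindelof F (tmin := t₀ - τ) (tmax := t₀ + τ) ⟨t₀, by constructor <;> linarith⟩
      x₀ (2 * c' * τ') 0 (c' + K * (2 * c' * τ')) K := by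
    refine ⟨fun t _ => (hL t).lipschitzOnWith, fun x _ => (hc x).continuousOn, ?_, ?_⟩
    · intro t ht x hx
      have h1 := (hL t).norm_sub_le x x₀
      have h2 := hcb t ht
      have h3 := norm_le_norm_sub_add (F t x) (F t x₀)
      have h4 : (K:ℝ) * ‖x - x₀‖ ≤ K * (2 * c * τ) := by
        gcongr
        simpa [dist_eq_norm, hc', hτ'] using hx
      simp only [NNReal.coe_add, NNReal.coe_mul, hc', hτ', NNReal.coe_ofNat]
      linarith
    · simp only [NNReal.coe_add, NNReal.coe_mul, hc', hτ', NNReal.coe_ofNat,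
        add_sub_cancel_left, sub_sub_cancel, max_self, NNReal.coe_zero, sub_zero]
      have : c * τ * (K * τ) ≤ c * τ * (1/2) := by gcongr
      nlinarith
  obtain ⟨x, hx0, hx⟩ := hPL.exists_eq_forall_mem_Icc_hasDerivWithinAt₀
  refine ⟨x, hx0, fun t ht => ?_⟩
  exact (hx t ⟨ht.1.le, ht.2.le⟩).hasDerivAt (Icc_mem_nhds ht.1 ht.2)

lemma steps_exists {E : Type*} [NormedAddCommGroup E] [NormedSpace ℝ E] [CompleteSpace E]
    (F : ℝ → E → E) (K : NNReal) (hL : ∀ t, LipschitzWith K (F t))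
    (hc : ∀ x, Continuous (fun t => F t x)) (τ : ℝ) (hτ : 0 < τ) (hKτ : K * τ ≤ 1 / 2)
    (t₀ : ℝ) (x₀ : E) (n : ℕ) :
    ∃ x : ℝ → E, x t₀ = x₀ ∧
      ∀ t ∈ Set.Ioo (t₀ - τ) (t₀ + (n + 2) * (τ / 2)), HasDerivAt x (F t (x t)) t := by
  induction n with
  | zero =>
    obtain ⟨x, h0, h1⟩ := local_exists F K hL hc τ hτ hKτ t₀ x₀
    refine ⟨x, h0, fun t ht => h1 t ⟨ht.1, ?_⟩⟩
    have := ht.2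
    simp at this
    linarith
  | succ n ih =>
    obtain ⟨x, h0, h1⟩ := ih
    set c := t₀ + (n + 1) * (τ / 2) with hcdef
    have hcpos : t₀ < c := by have : 0 < (n + 1) * (τ / 2) := by positivity
                              linarith
    obtain ⟨y, hy0, hy1⟩ := local_exists F K hL hc τ hτ hKτ c (x c)
    refine ⟨fun t => if t ≤ c then x t else y t, by simp [hcpos.le, h0], ?_⟩
    intro t ht
    obtain ⟨ht1, ht2⟩ := ht
    push_cast at ht2
    rcases lt_trichotomy t c with h | h | h
    · have hx := h1 t ⟨ht1, by linarith⟩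
      simp only [h.le, if_true]
      refine hx.congr_of_eventuallyEq ?_
      filter_upwards [Iio_mem_nhds h] with s hs
      simp [(show s < c from hs).le]
    · clear_value c
      subst h
      simp only [le_refl, if_true]
      have hx := h1 t ⟨ht1, by linarith⟩
      have hy := hy1 t ⟨by linarith, by linarith⟩
      rw [hy0] at hy
      have e1 : HasDerivWithinAt (fun s => if s ≤ t then x s else y s) (F t (x t)) (Set.Iic t) t := by
        refine hx.hasDerivWithinAt.congr (fun s hs => ?_) (by simp)
        simp [show s ≤ t from hs]
      have e2 : HasDerivWithinAt (fun s => if s ≤ t then x s else y s) (F t (x t)) (Set.Ici t) t := by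
        refine hy.hasDerivWithinAt.congr (fun s hs => ?_) (by simp [hy0])
        rcases eq_or_lt_of_le (show t ≤ s from hs) with h | h
        · subst h; simp [hy0]
        · simp [not_le.2 h]
      have := e1.union e2
      rwa [Set.Iic_union_Ici, hasDerivWithinAt_univ] at this
    · have hy := hy1 t ⟨by linarith, by linarith⟩
      simp only [not_le.2 h, if_false]
      refine hy.congr_of_eventuallyEq ?_
      filter_upwards [Ioi_mem_nhds h] with s hs
      simp [not_le.2 (show c < s from hs)]

lemma global_exists {E : Type*} [NormedAddCommGroup E] [NormedSpace ℝ E] [CompleteSpace E]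
    (F : ℝ → E → E) (K : NNReal) (hL : ∀ t, LipschitzWith K (F t))
    (hc : ∀ x, Continuous (fun t => F t x)) (t₀ : ℝ) (x₀ : E) :
    ∃ x : ℝ → E, x t₀ = x₀ ∧ ∀ t ≥ t₀, HasDerivAt x (F t (x t)) t := by
  obtain ⟨τ, hτ, hKτ⟩ : ∃ τ : ℝ, 0 < τ ∧ K * τ ≤ 1 / 2 := by
    refine ⟨1 / (2 * (K + 1)), by positivity, ?_⟩
    have : (0:ℝ) ≤ K := K.2
    rw [mul_one_div, div_le_div_iff₀ (by positivity) (by positivity)]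
    linarith
  choose X hX0 hX using fun n => steps_exists F K hL hc τ hτ hKτ t₀ x₀ n
  have huniq : ∀ m n : ℕ, m ≤ n → ∀ t ∈ Set.Ioo (t₀ - τ) (t₀ + (m + 2) * (τ / 2)), X m t = X n t := by
    intro m n hmn
    have hmn' : (m : ℝ) ≤ n := by exact_mod_cast hmn
    refine ODE_solution_unique_of_mem_Ioo (v := F) (K := K) (s := fun _ => Set.univ) (t₀ := t₀)
      (fun t _ => (hL t).lipschitzOnWith) ?_ (fun t ht => ⟨hX m t ht, trivial⟩)
      (fun t ht => ⟨hX n t ⟨ht.1, lt_of_lt_of_le ht.2 ?_⟩, trivial⟩) (by rw [hX0, hX0])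
    · constructor
      · linarith
      · have : 0 < (m + 2) * (τ / 2) := by positivity
        linarith
    · gcongr
  let ν : ℝ → ℕ := fun t => ⌈(t - t₀) / (τ / 2)⌉₊
  have hν : ∀ t, t < t₀ + (ν t + 2) * (τ / 2) := by
    intro t
    have h1 : (t - t₀) / (τ / 2) ≤ ν t := Nat.le_ceil _
    rw [div_le_iff₀ (by positivity)] at h1
    linarith
  refine ⟨fun t => X (ν t) t, hX0 _, ?_⟩
  intro t ht
  have hev : (fun s => X (ν s) s) =ᶠ[nhds t] X (ν t) := by
    filter_upwards [Ioo_mem_nhds (show t₀ - τ < t by linarith) (hν t)] with s hs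
    rcases le_total (ν s) (ν t) with h | h
    · exact huniq _ _ h s ⟨hs.1, hν s⟩
    · exact (huniq _ _ h s hs).symm
  exact (hX (ν t) t ⟨by linarith, hν t⟩).congr_of_eventuallyEq hev

lemma scalar_decay (V V' : ℝ → ℝ) (t₁ β γ : ℝ) (hβ : 0 < β) (hγ : 0 ≤ γ)
    (hV : ∀ t ≥ t₁, HasDerivAt V (V' t) t) (hb : ∀ t ≥ t₁, V' t ≤ -β * V t + γ) :
    ∀ t ≥ t₁, V t ≤ V t₁ * Real.exp (-β * (t - t₁)) + γ / β := by
  intro t ht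
  have := le_gronwallBound_of_liminf_deriv_right_le (f := V) (f' := V') (δ := V t₁) (K := -β) (ε := γ)
    (a := t₁) (b := t) (fun s hs => (hV s hs.1).continuousAt.continuousWithinAt)
    (fun s hs r hr => (hV s hs.1).hasDerivWithinAt.liminf_right_slope_le hr) le_rfl
    (fun s hs => hb s hs.1) t ⟨ht, le_rfl⟩
  rw [gronwallBound_of_K_ne_0 (by linarith)] at this
  refine this.trans ?_
  have h1 : γ / -β * (Real.exp (-β * (t - t₁)) - 1) = γ / β - γ / β * Real.exp (-β * (t - t₁)) := by
    rw [div_neg]; ring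
  have h2 : 0 ≤ γ / β * Real.exp (-β * (t - t₁)) := by positivity
  linarith

lemma pert_gronwall {E : Type*} [NormedAddCommGroup E] [NormedSpace ℝ E]
    (D D' : ℝ → E) (t₁ T L a b c : ℝ) (hL : 0 ≤ L) (ha : 0 ≤ a) (hb : 0 < b) (hc : 0 < c)
    (hD : ∀ t ∈ Set.Icc t₁ (t₁ + T), HasDerivAt D (D' t) t)
    (bound : ∀ t ∈ Set.Icc t₁ (t₁ + T),
      ‖D' t‖ ≤ L * ‖D t‖ + a * Real.exp (-b * (t - t₁)) + c) :
    ∀ t ∈ Set.Icc t₁ (t₁ + T), ‖D t‖ ≤ (‖D t₁‖ + a / b + 2 * c * T) * Real.exp (L * T) := by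
  intro t ht
  set B : ℝ → ℝ := fun t => (‖D t₁‖ + a / b * (1 - Real.exp (-b * (t - t₁))) + 2 * c * (t - t₁))
    * Real.exp (L * (t - t₁)) with hB
  have hBd : ∀ x, HasDerivAt B ((a * Real.exp (-b * (x - t₁)) + 2 * c) * Real.exp (L * (x - t₁))
      + L * B x) x := by
    intro x
    have e0 : HasDerivAt (fun x : ℝ => x - t₁) 1 x := (hasDerivAt_id x).sub_const t₁
    have e1 : HasDerivAt (fun x : ℝ => Real.exp (-b * (x - t₁))) (Real.exp (-b * (x - t₁)) * (-b * 1)) x :=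
      (e0.const_mul (-b)).exp
    have e2 : HasDerivAt (fun x : ℝ => Real.exp (L * (x - t₁))) (Real.exp (L * (x - t₁)) * (L * 1)) x :=
      (e0.const_mul L).exp
    have e3 := ((((e1.const_sub 1).const_mul (a / b)).const_add ‖D t₁‖).add (e0.const_mul (2 * c))).mul e2
    refine e3.congr_deriv ?_
    simp only [hB, Pi.add_apply]
    field_simp
  have main := image_norm_le_of_norm_deriv_right_lt_deriv_boundary (f := D) (f' := D') (a := t₁)
    (b := t₁ + T) (fun s hs => (hD s hs).continuousAt.continuousWithinAt)
    (fun s hs => (hD s ⟨hs.1, hs.2.le⟩).hasDerivWithinAt) (B := B) (by simp [hB]) hBd ?_ ht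
  · refine main.trans ?_
    simp only [hB]
    have h1 := ht.1
    have h2 : t - t₁ ≤ T := by linarith [ht.2]
    have h3 : Real.exp (-b * (t - t₁)) ≤ 1 := by
      rw [Real.exp_le_one_iff]; nlinarith
    have h4 := Real.exp_pos (-b * (t - t₁))
    have h5 : 0 ≤ T := by linarith
    gcongr
    have : 0 ≤ a / b := by positivity
    nlinarith
  · intro x hx heq
    have h1 := bound x ⟨hx.1, hx.2.le⟩
    rw [heq] at h1
    have h2 : 1 ≤ Real.exp (L * (x - t₁)) := by
      rw [Real.one_le_exp_iff]; exact mul_nonneg hL (by linarith [hx.1])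
    have h3 : 0 ≤ a * Real.exp (-b * (x - t₁)) := by positivity
    nlinarith

lemma lap_gap {N n : ℕ} (hN : 2 ≤ N) (α : Fin N → Fin N → ℝ)
    (hsym : ∀ i j, α i j = α j i) (hnn : ∀ i j, 0 ≤ α i j)
    (hconn : LinearMap.ker (lapMat α).mulVecLin
      = Submodule.span ℝ {(fun _ => 1 : Fin N → ℝ)})
    (Λ : Matrix (Fin n) (Fin n) ℝ) (hΛ : Λ.PosDef) :
    ∃ lam > (0:ℝ), ∀ v : Fin N → Fin n → ℝ, ∑ i, v i = 0 →
      ∑ i, v i ⬝ᵥ Λ.mulVec (∑ j, α i j • (v j - v i)) ≤ -lam * ∑ i, ∑ l, v i l ^ 2 := by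
  set Q : (Fin N → Fin n → ℝ) → ℝ := fun v => ∑ i, ∑ j, α i j * ((v i - v j) ⬝ᵥ Λ.mulVec (v i - v j))
    with hQ
  have hQS : ∀ v : Fin N → Fin n → ℝ, ∑ i, v i ⬝ᵥ Λ.mulVec (∑ j, α i j • (v j - v i)) = -(1/2) * Q v := by
    intro v
    have e1 : ∑ i, v i ⬝ᵥ Λ.mulVec (∑ j, α i j • (v j - v i))
        = ∑ i, ∑ j, α i j * (v i ⬝ᵥ Λ.mulVec (v j - v i)) := by
      refine Finset.sum_congr rfl fun i _ => ?_
      rw [Matrix.mulVec_sum, dotProduct_sum]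
      refine Finset.sum_congr rfl fun j _ => ?_
      rw [Matrix.mulVec_smul, dotProduct_smul, smul_eq_mul]
    have e2 : ∑ i, ∑ j, α i j * (v i ⬝ᵥ Λ.mulVec (v j - v i))
        = ∑ i, ∑ j, α i j * (v j ⬝ᵥ Λ.mulVec (v i - v j)) := by
      rw [Finset.sum_comm]
      refine Finset.sum_congr rfl fun i _ => Finset.sum_congr rfl fun j _ => ?_
      rw [hsym]
    have e3 : Q v = -(∑ i, ∑ j, α i j * (v i ⬝ᵥ Λ.mulVec (v j - v i)))
        - ∑ i, ∑ j, α i j * (v j ⬝ᵥ Λ.mulVec (v i - v j)) := by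
      simp only [hQ, ← Finset.sum_neg_distrib, ← Finset.sum_sub_distrib]
      refine Finset.sum_congr rfl fun i _ => Finset.sum_congr rfl fun j _ => ?_
      have : v j - v i = -(v i - v j) := by abel
      rw [this, Matrix.mulVec_neg, sub_dotProduct, dotProduct_neg]
      ring
    rw [e1]
    rw [← e2] at e3
    linarith
  have hΛ0 : ∀ x : Fin n → ℝ, 0 ≤ x ⬝ᵥ Λ.mulVec x := fun x => by
    simpa using hΛ.posSemidef.dotProduct_mulVec_nonneg x
  have hQ0 : ∀ v, 0 ≤ Q v := fun v => Finset.sum_nonneg fun i _ => Finset.sum_nonneg fun j _ =>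
    mul_nonneg (hnn i j) (hΛ0 _)
  have hQz : ∀ v : Fin N → Fin n → ℝ, ∑ i, v i = 0 → Q v = 0 → v = 0 := by
    intro v hv hq
    have h1 : ∀ i j, α i j * ((v i - v j) ⬝ᵥ Λ.mulVec (v i - v j)) = 0 := by
      intro i j
      have := (Finset.sum_eq_zero_iff_of_nonneg (fun i _ => Finset.sum_nonneg fun j _ =>
        mul_nonneg (hnn i j) (hΛ0 _))).1 hq i (Finset.mem_univ i)
      exact (Finset.sum_eq_zero_iff_of_nonneg (fun j _ =>
        mul_nonneg (hnn i j) (hΛ0 _))).1 this j (Finset.mem_univ j)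
    have h2 : ∀ i j, α i j • (v i - v j) = 0 := by
      intro i j
      rcases mul_eq_zero.1 (h1 i j) with h | h
      · simp [h]
      · by_cases hz : v i - v j = 0
        · simp [hz]
        · have := hΛ.dotProduct_mulVec_pos hz
          simp only [star_trivial] at this
          linarith
    funext i l
    have h3 : (fun i => v i l) ∈ LinearMap.ker (lapMat α).mulVecLin := by
      rw [LinearMap.mem_ker]
      funext i
      simp only [Matrix.mulVecLin_apply, Matrix.mulVec, dotProduct, lapMat, Matrix.of_apply, sub_mul,
        ite_mul, zero_mul, Finset.sum_sub_distrib, Finset.sum_ite_eq, Finset.mem_univ, if_true,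
        Pi.zero_apply, Finset.sum_mul]
      rw [← Finset.sum_sub_distrib]
      refine Finset.sum_eq_zero fun j _ => ?_
      have := congrFun (h2 i j) l
      simp only [Pi.smul_apply, Pi.sub_apply, smul_eq_mul, Pi.zero_apply] at this
      linarith
    rw [hconn, Submodule.mem_span_singleton] at h3
    obtain ⟨c, hc⟩ := h3
    have h4 : ∀ i, v i l = c := fun i => by
      have := congrFun hc i
      simpa using this.symm
    have h5 := congrFun hv l
    simp only [Finset.sum_apply, h4, Finset.sum_const, Finset.card_univ, Fintype.card_fin, nsmul_eq_mul,
      Pi.zero_apply] at h5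
    rw [h4]
    have : (N:ℝ) ≠ 0 := by positivity
    simpa [this] using h5
  have hQc : Continuous Q := by
    simp only [hQ, dotProduct, Matrix.mulVec]
    fun_prop
  have hQhom : ∀ (c : ℝ) v, Q (c • v) = c ^ 2 * Q v := by
    intro c v
    simp only [hQ, Finset.mul_sum, Pi.smul_apply, ← smul_sub, Matrix.mulVec_smul, dotProduct_smul,
      smul_dotProduct, smul_eq_mul]
    refine Finset.sum_congr rfl fun i _ => Finset.sum_congr rfl fun j _ => ?_
    ring
  obtain ⟨μ, hμ, hμQ⟩ : ∃ μ > (0:ℝ), ∀ v : Fin N → Fin n → ℝ, ∑ i, v i = 0 → μ * ‖v‖ ^ 2 ≤ Q v := by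
    set S : Set (Fin N → Fin n → ℝ) := Metric.sphere 0 1 ∩ {v | ∑ i, v i = 0} with hS
    have hSc : IsCompact S := (isCompact_sphere _ _).inter_right
      (isClosed_eq (by fun_prop) continuous_const)
    obtain ⟨μ, hμ, hm⟩ : ∃ μ > (0:ℝ), ∀ v ∈ S, μ ≤ Q v := by
      rcases S.eq_empty_or_nonempty with h | h
      · exact ⟨1, one_pos, by simp [h]⟩
      · obtain ⟨v, hv, hmin⟩ := hSc.exists_isMinOn h hQc.continuousOn
        refine ⟨Q v, lt_of_le_of_ne (hQ0 v) (fun h0 => ?_), fun w hw => hmin hw⟩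
        have := hQz v hv.2 h0.symm
        have h1 := hv.1
        simp [this] at h1
    refine ⟨μ, hμ, fun v hv => ?_⟩
    by_cases h0 : v = 0
    · subst h0; simp [hQ]
    · have hn : ‖v‖ ≠ 0 := norm_ne_zero_iff.2 h0
      have := hm (‖v‖⁻¹ • v) ⟨by simp [norm_smul, hn], by
        simp only [Set.mem_setOf_eq, Pi.smul_apply, ← Finset.smul_sum, hv, smul_zero]⟩
      rw [hQhom] at this
      have h2 : 0 < ‖v‖ ^ 2 := by positivity
      calc μ * ‖v‖ ^ 2 ≤ (‖v‖⁻¹ ^ 2 * Q v) * ‖v‖ ^ 2 := by gcongr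
        _ = Q v := by field_simp
  refine ⟨μ / (2 * (N * n + 1)), by positivity, fun v hv => ?_⟩
  rw [hQS]
  have h1 := hμQ v hv
  have h2 : ∑ i, ∑ l, v i l ^ 2 ≤ (N * n + 1) * ‖v‖ ^ 2 := by
    calc ∑ i, ∑ l, v i l ^ 2 ≤ ∑ i : Fin N, ∑ l : Fin n, ‖v‖ ^ 2 := by
          refine Finset.sum_le_sum fun i _ => Finset.sum_le_sum fun l _ => ?_
          have := (norm_le_pi_norm (v i) l).trans (norm_le_pi_norm v i)
          rw [Real.norm_eq_abs] at this
          exact sq_le_sq' (by linarith [neg_abs_le (v i l)]) (by linarith [le_abs_self (v i l)])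
      _ = N * n * ‖v‖ ^ 2 := by simp; ring
      _ ≤ _ := by gcongr; linarith
  have h3 : μ / (2 * (N * n + 1)) * ∑ i, ∑ l, v i l ^ 2 ≤ μ / (2 * (N * n + 1)) * ((N * n + 1) * ‖v‖ ^ 2) := by
    gcongr
  have h4 : μ / (2 * (N * n + 1)) * ((N * n + 1) * ‖v‖ ^ 2) = μ * ‖v‖ ^ 2 / 2 := by
    field_simp
  linarith

lemma sync_decay {N n : ℕ} (hN : 2 ≤ N) (α : Fin N → Fin N → ℝ)
    (hsym : ∀ i j, α i j = α j i) (Λ : Matrix (Fin n) (Fin n) ℝ) (lam : ℝ) (hlam : 0 < lam)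
    (gap : ∀ v : Fin N → Fin n → ℝ, ∑ i, v i = 0 →
      ∑ i, v i ⬝ᵥ Λ.mulVec (∑ j, α i j • (v j - v i)) ≤ -lam * ∑ i, ∑ l, v i l ^ 2)
    (k M t₀ a : ℝ) (hk : 0 < k) (hM : 0 ≤ M) (ha : 0 ≤ a)
    (y H : Fin N → ℝ → Fin n → ℝ) (s : ℝ → Fin n → ℝ)
    (hs : ∀ t, s t = (N : ℝ)⁻¹ • ∑ i, y i t)
    (hy : ∀ i, ∀ t ≥ t₀,
      HasDerivAt (y i) (H i t + k • Λ.mulVec (∑ j, α i j • (y j t - y i t))) t)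
    (hH : ∀ i t, ‖H i t‖ ≤ M)
    (h0 : ∑ i, ∑ l, (y i t₀ l - s t₀ l) ^ 2 ≤ a ^ 2) :
    (∀ t ≥ t₀, HasDerivAt s ((N : ℝ)⁻¹ • ∑ i, H i t) t) ∧
    (∀ t ≥ t₀, ∀ i, ‖y i t - s t‖ ≤
      a * Real.exp (-(k * lam / 2) * (t - t₀)) + (2 * M * (N * n + 1) / lam) / k) := by
  have hN0 : (N:ℝ) ≠ 0 := by positivity
  have hz : ∀ t, ∑ i, Λ.mulVec (∑ j, α i j • (y j t - y i t)) = 0 := by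
    intro t
    rw [← Matrix.mulVec_sum]
    have : ∑ i, ∑ j, α i j • (y j t - y i t) = 0 := by
      have e1 : ∑ i, ∑ j, α i j • (y j t - y i t) = ∑ i, ∑ j, α i j • (y i t - y j t) := by
        rw [Finset.sum_comm]
        exact Finset.sum_congr rfl fun i _ => Finset.sum_congr rfl fun j _ => by rw [hsym]
      have e2 : ∑ i, ∑ j, α i j • (y i t - y j t) = -∑ i, ∑ j, α i j • (y j t - y i t) := by
        simp only [← Finset.sum_neg_distrib]
        refine Finset.sum_congr rfl fun i _ => Finset.sum_congr rfl fun j _ => ?_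
        rw [← smul_neg, neg_sub]
      rw [e2] at e1
      exact self_eq_neg.1 e1
    rw [this, Matrix.mulVec_zero]
  have hsd : ∀ t ≥ t₀, HasDerivAt s ((N : ℝ)⁻¹ • ∑ i, H i t) t := by
    intro t ht
    have e : s = fun t => (N : ℝ)⁻¹ • ∑ i, y i t := funext hs
    rw [e]
    have := (HasDerivAt.fun_sum (u := Finset.univ) (fun i _ => hy i t ht)).const_smul ((N:ℝ)⁻¹)
    refine this.congr_deriv ?_
    rw [Finset.sum_add_distrib, ← Finset.smul_sum, hz, smul_zero, add_zero]
  refine ⟨hsd, ?_⟩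
  set e : Fin N → ℝ → Fin n → ℝ := fun i t => y i t - s t with he
  set f : Fin N → ℝ → Fin n → ℝ := fun i t => H i t - (N : ℝ)⁻¹ • ∑ i, H i t with hf
  have hfb : ∀ i t l, |f i t l| ≤ 2 * M := by
    intro i t l
    rw [← Real.norm_eq_abs]
    refine (norm_le_pi_norm (f i t) l).trans ((norm_sub_le _ _).trans ?_)
    have h1 := hH i t
    have h2 : ‖(N : ℝ)⁻¹ • ∑ i, H i t‖ ≤ M := by
      rw [norm_smul, norm_inv, Real.norm_natCast]
      have : ‖∑ i, H i t‖ ≤ ∑ _i : Fin N, M := norm_sum_le_of_le _ fun i _ => hH i t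
      simp only [Finset.sum_const, Finset.card_univ, Fintype.card_fin, nsmul_eq_mul] at this
      calc (N:ℝ)⁻¹ * ‖∑ i, H i t‖ ≤ (N:ℝ)⁻¹ * (N * M) := by gcongr
        _ = M := by field_simp
    linarith
  have hed : ∀ i, ∀ t ≥ t₀, HasDerivAt (e i)
      (f i t + k • Λ.mulVec (∑ j, α i j • (e j t - e i t))) t := by
    intro i t ht
    refine ((hy i t ht).sub (hsd t ht)).congr_deriv ?_
    simp only [he, hf, sub_sub_sub_cancel_right]
    abel
  have hsum : ∀ t, ∑ i, e i t = 0 := by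
    intro t
    simp only [he, Finset.sum_sub_distrib, Finset.sum_const, Finset.card_univ, Fintype.card_fin, hs]
    rw [← Nat.cast_smul_eq_nsmul ℝ, smul_smul, mul_inv_cancel₀ hN0, one_smul, sub_self]
  set V : ℝ → ℝ := fun t => ∑ i, ∑ l, e i t l ^ 2 with hV
  have hVd : ∀ t ≥ t₀, HasDerivAt V (∑ i, ∑ l, 2 * e i t l *
      (f i t + k • Λ.mulVec (∑ j, α i j • (e j t - e i t))) l) t := by
    intro t ht
    refine HasDerivAt.fun_sum fun i _ => HasDerivAt.fun_sum fun l _ => ?_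
    have := (hasDerivAt_pi.1 (hed i t ht) l).pow 2
    refine this.congr_deriv ?_
    simp
  have hVb : ∀ t ≥ t₀, ∑ i, ∑ l, 2 * e i t l *
      (f i t + k • Λ.mulVec (∑ j, α i j • (e j t - e i t))) l
        ≤ -(k * lam) * V t + N * n * (4 * M ^ 2 / (k * lam)) := by
    intro t ht
    have e1 : ∑ i, ∑ l, 2 * e i t l * (f i t + k • Λ.mulVec (∑ j, α i j • (e j t - e i t))) l
        = ∑ i, ∑ l, 2 * e i t l * f i t l
          + 2 * k * ∑ i, e i t ⬝ᵥ Λ.mulVec (∑ j, α i j • (e j t - e i t)) := by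
      rw [Finset.mul_sum, ← Finset.sum_add_distrib]
      refine Finset.sum_congr rfl fun i _ => ?_
      rw [dotProduct, Finset.mul_sum, ← Finset.sum_add_distrib]
      refine Finset.sum_congr rfl fun l _ => ?_
      simp only [Pi.add_apply, Pi.smul_apply, smul_eq_mul]
      ring
    have e2 := gap (fun i => e i t) (hsum t)
    have hkl : 0 < k * lam := by positivity
    have e3 : ∑ i, ∑ l, 2 * e i t l * f i t l ≤
        ∑ i : Fin N, ∑ l : Fin n, (k * lam * e i t l ^ 2 + 4 * M ^ 2 / (k * lam)) := by
      refine Finset.sum_le_sum fun i _ => Finset.sum_le_sum fun l _ => ?_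
      have h1 := abs_le.1 (hfb i t l)
      have h2 : f i t l ^ 2 ≤ 4 * M ^ 2 := by nlinarith
      have h3 : 2 * e i t l * f i t l ≤ k * lam * e i t l ^ 2 + f i t l ^ 2 / (k * lam) := by
        have : k * lam * e i t l ^ 2 + f i t l ^ 2 / (k * lam) - 2 * e i t l * f i t l
            = (k * lam * e i t l - f i t l) ^ 2 / (k * lam) := by
          field_simp
          ring
        have h4 : 0 ≤ (k * lam * e i t l - f i t l) ^ 2 / (k * lam) := by positivity
        linarith
      have h5 : f i t l ^ 2 / (k * lam) ≤ 4 * M ^ 2 / (k * lam) := by gcongr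
      linarith
    have e4 : ∑ i : Fin N, ∑ l : Fin n, (k * lam * e i t l ^ 2 + 4 * M ^ 2 / (k * lam))
        = k * lam * V t + N * n * (4 * M ^ 2 / (k * lam)) := by
      simp only [Finset.sum_add_distrib, ← Finset.mul_sum, hV]
      simp
      ring
    rw [e1]
    have e5 : 2 * k * ∑ i, e i t ⬝ᵥ Λ.mulVec (∑ j, α i j • (e j t - e i t)) ≤ 2 * k * (-lam * V t) := by
      gcongr
    nlinarith
  have hdec := scalar_decay V _ t₀ (k * lam) (N * n * (4 * M ^ 2 / (k * lam))) (by positivity)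
    (by positivity) hVd hVb
  intro t ht i
  have h1 := hdec t ht
  set x := Real.exp (-(k * lam / 2) * (t - t₀)) with hx
  have hx2 : Real.exp (-(k * lam) * (t - t₀)) = x ^ 2 := by
    rw [hx, ← Real.exp_nat_mul]; congr 1; push_cast; ring
  have hx0 : 0 < x := Real.exp_pos _
  set c := 2 * M * (N * n + 1) / lam / k with hc
  have hc0 : 0 ≤ c := by positivity
  have h2 : N * n * (4 * M ^ 2 / (k * lam)) / (k * lam) ≤ c ^ 2 := by
    have e1 : N * n * (4 * M ^ 2 / (k * lam)) / (k * lam) = (N * n : ℝ) * (2 * M / lam / k) ^ 2 := by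
      field_simp; ring
    have e2 : c ^ 2 = (N * n + 1 : ℝ) ^ 2 * (2 * M / lam / k) ^ 2 := by
      rw [hc]; field_simp
    rw [e1, e2]
    gcongr
    have : (0:ℝ) ≤ N * n := by positivity
    nlinarith
  have h3 : V t ≤ (a * x + c) ^ 2 := by
    have e1 : V t₀ * x ^ 2 ≤ a ^ 2 * x ^ 2 := by
      gcongr
      exact h0
    have e2 : 0 ≤ a * x * c := by positivity
    rw [hx2] at h1
    nlinarith
  rw [pi_norm_le_iff_of_nonneg (by positivity)]
  intro l
  rw [Real.norm_eq_abs]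
  refine abs_le_of_sq_le_sq (le_trans ?_ h3) (by positivity)
  calc (e i t l) ^ 2 ≤ ∑ l, e i t l ^ 2 :=
        Finset.single_le_sum (f := fun l => e i t l ^ 2) (fun _ _ => sq_nonneg _) (Finset.mem_univ l)
    _ ≤ V t := Finset.single_le_sum (f := fun i => ∑ l, e i t l ^ 2)
        (fun _ _ => Finset.sum_nonneg fun _ _ => sq_nonneg _) (Finset.mem_univ i)

lemma UAS_norm {ι : Type*} [Fintype ι] {F : ℝ → (ι → ℝ) → ι → ℝ} {A D : Set (ι → ℝ)}
    (hA : A.Nonempty) (hU : UAS F A D) :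
    (∀ ε > 0, ∃ δ > 0, ∀ (t₀ : ℝ) (x : ℝ → ι → ℝ), IsSolOn F x t₀ →
      (∃ a ∈ A, ‖x t₀ - a‖ < δ) → ∀ t ≥ t₀, ∃ a ∈ A, ‖x t - a‖ < ε) ∧
    (∀ C : Set (ι → ℝ), IsCompact C → C ⊆ D →
      (∀ (t₀ : ℝ), ∀ x₀ ∈ C, ∃ x : ℝ → ι → ℝ, x t₀ = x₀ ∧ IsSolOn F x t₀) ∧
      (∀ ε > 0, ∃ T > 0, ∀ (t₀ : ℝ) (x : ℝ → ι → ℝ), IsSolOn F x t₀ → x t₀ ∈ C →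
        ∀ t ≥ t₀ + T, ∃ a ∈ A, ‖x t - a‖ < ε)) := by
  refine ⟨fun ε hε => ?_, fun C hC hCD => ⟨(hU.2 C hC hCD).1, fun ε hε => ?_⟩⟩
  · obtain ⟨δ, hδ, h⟩ := hU.1 ε hε
    have hc : (0:ℝ) < Fintype.card ι + 1 := by positivity
    refine ⟨δ / (Fintype.card ι + 1), by positivity, fun t₀ x hx ⟨a, ha, hxa⟩ t ht => ?_⟩
    refine einfDist_lt hA (h t₀ x hx ((einfDist_le ha).trans_lt ?_) t ht)
    rw [lt_div_iff₀ hc] at hxa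
    linarith
  · obtain ⟨T, hT, h⟩ := (hU.2 C hC hCD).2 ε hε
    exact ⟨T, hT, fun t₀ x hx hxc t ht => einfDist_lt hA (h t₀ x hx hxc t ht)⟩

lemma tracking {ι : Type*} [Fintype ι] (F : ℝ → (ι → ℝ) → ι → ℝ) (A C : Set (ι → ℝ))
    (p : ℝ → ι → ℝ) (t₀ t₁ T ε δ κ Rp : ℝ) (ht₁ : t₀ ≤ t₁) (hT : 0 < T)
    (hp : ∀ s ≥ t₀, ∀ x, IsSolOn F x s → x s = p s → (∀ t ∈ Set.Icc s (s + T), ‖x t‖ ≤ Rp) →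
      ∀ t ∈ Set.Icc s (s + T), ‖p t - x t‖ ≤ κ)
    (hκδ : κ ≤ δ / 2) (hκε : κ ≤ ε / 2) (hε : 0 < ε)
    (hS : ∀ (s : ℝ) (x : ℝ → ι → ℝ), IsSolOn F x s →
      (∃ a ∈ A, ‖x s - a‖ < δ) → ∀ t ≥ s, ∃ a ∈ A, ‖x t - a‖ < ε / 2)
    (hAt : ∀ (s : ℝ) (x : ℝ → ι → ℝ), IsSolOn F x s → x s ∈ C →
        ∀ t ≥ s + T, ∃ a ∈ A, ‖x t - a‖ < δ / 2)
    (hE : ∀ s, ∀ x₀ ∈ C, ∃ x : ℝ → ι → ℝ, x s = x₀ ∧ IsSolOn F x s)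
    (hC : ∀ x, (∃ a ∈ A, ‖x - a‖ < δ) → x ∈ C)
    (hR : ∀ x, (∃ a ∈ A, ‖x - a‖ < ε) → ‖x‖ ≤ Rp)
    (h1 : ∃ a ∈ A, ‖p t₁ - a‖ < δ) :
    ∀ t ≥ t₁, ∃ a ∈ A, ‖p t - a‖ < ε := by
  have step : ∀ s ≥ t₀, (∃ a ∈ A, ‖p s - a‖ < δ) →
      (∀ t ∈ Set.Icc s (s + T), ∃ a ∈ A, ‖p t - a‖ < ε) ∧ ∃ a ∈ A, ‖p (s + T) - a‖ < δ := by
    intro s hs hps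
    obtain ⟨x, hx0, hx⟩ := hE s (p s) (hC _ hps)
    have hst := hS s x hx (by rwa [hx0])
    have hcl := hp s hs x hx hx0 (fun t ht => hR _ (by
      obtain ⟨a, ha, h⟩ := hst t ht.1
      exact ⟨a, ha, by linarith⟩))
    have tri : ∀ t a, ‖p t - a‖ ≤ ‖p t - x t‖ + ‖x t - a‖ := fun t a => norm_sub_le_norm_sub_add_norm_sub _ _ _
    constructor
    · intro t ht
      obtain ⟨a, ha, h⟩ := hst t ht.1
      exact ⟨a, ha, by linarith [tri t a, hcl t ht]⟩
    · obtain ⟨a, ha, h⟩ := hAt s x hx (by rw [hx0]; exact hC _ hps) (s + T) le_rfl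
      exact ⟨a, ha, by linarith [tri (s + T) a, hcl (s + T) ⟨by linarith, le_rfl⟩]⟩
  have ind : ∀ n : ℕ, ∃ a ∈ A, ‖p (t₁ + n * T) - a‖ < δ := by
    intro n
    induction n with
    | zero => simpa using h1
    | succ n ih =>
      have h0 : 0 ≤ n * T := by positivity
      have := (step _ (by linarith) ih).2
      push_cast
      rwa [add_mul, one_mul, ← add_assoc]
  intro t ht
  have h0 : 0 ≤ (t - t₁) / T := div_nonneg (by linarith) hT.le
  have hn1 := Nat.floor_le h0
  have hn2 := Nat.lt_floor_add_one ((t - t₁) / T)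
  rw [le_div_iff₀ hT] at hn1
  rw [div_lt_iff₀ hT] at hn2
  have h00 : 0 ≤ (⌊(t - t₁) / T⌋₊ : ℝ) * T := by positivity
  exact (step _ (by linarith) (ind ⌊(t - t₁) / T⌋₊)).1 t ⟨by linarith, by linarith⟩

lemma net_exists {N n : ℕ} (m : Fin N → ℕ) (t₀ : ℝ) (α : Fin N → Fin N → ℝ)
    (Λ : Matrix (Fin n) (Fin n) ℝ)
    (g : (i : Fin N) → ℝ → (Fin (m i) → ℝ) → (Fin n → ℝ) → Fin (m i) → ℝ)
    (h : (i : Fin N) → ℝ → (Fin n → ℝ) → (Fin (m i) → ℝ) → Fin n → ℝ)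
    (L : ℝ) (hL : 0 ≤ L)
    (hgc : ∀ i, Continuous (fun p : ℝ × (Fin (m i) → ℝ) × (Fin n → ℝ) => g i p.1 p.2.1 p.2.2))
    (hhc : ∀ i, Continuous (fun p : ℝ × (Fin n → ℝ) × (Fin (m i) → ℝ) => h i p.1 p.2.1 p.2.2))
    (hgl : ∀ i t p q p' q', ‖g i t p q - g i t p' q'‖ ≤ L * max ‖p - p'‖ ‖q - q'‖)
    (hhl : ∀ i t p q p' q', ‖h i t p q - h i t p' q'‖ ≤ L * max ‖p - p'‖ ‖q - q'‖)
    (k : ℝ) (z₀ : (i : Fin N) → Fin (m i) → ℝ) (y₀ : Fin N → Fin n → ℝ) :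
    ∃ (z : (i : Fin N) → ℝ → Fin (m i) → ℝ) (y : Fin N → ℝ → Fin n → ℝ),
      (∀ i, z i t₀ = z₀ i) ∧ (∀ i, y i t₀ = y₀ i) ∧
      (∀ i, ∀ t ≥ t₀,
          HasDerivAt (z i) (g i t (z i t) (y i t)) t ∧
          HasDerivAt (y i)
            (h i t (y i t) (z i t) + k • Λ.mulVec (∑ j, α i j • (y j t - y i t))) t) := by
  let ℓ : (Fin N → Fin n → ℝ) →ₗ[ℝ] (Fin N → Fin n → ℝ) :=
    { toFun := fun y i => k • Λ.mulVec (∑ j, α i j • (y j - y i))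
      map_add' := by
        intro u v
        funext i
        have e : (∑ j, α i j • ((u + v) j - (u + v) i)) =
            (∑ j, α i j • (u j - u i)) + ∑ j, α i j • (v j - v i) := by
          rw [← Finset.sum_add_distrib]
          refine Finset.sum_congr rfl fun j _ => ?_
          rw [← smul_add]
          congr 1
          simp only [Pi.add_apply]
          abel
        simp only [Pi.add_apply] at e ⊢
        rw [e, Matrix.mulVec_add, smul_add]
      map_smul' := by
        intro c u
        funext i
        have e : (∑ j, α i j • ((c • u) j - (c • u) i)) =
            c • (∑ j, α i j • (u j - u i)) := by
          rw [Finset.smul_sum]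
          refine Finset.sum_congr rfl fun j _ => ?_
          simp only [Pi.smul_apply]
          rw [← smul_sub, smul_comm]
        simp only [Pi.smul_apply, RingHom.id_apply] at e ⊢
        rw [e, Matrix.mulVec_smul, smul_comm] }
  have hℓ : ∀ y i, ℓ y i = k • Λ.mulVec (∑ j, α i j • (y j - y i)) := fun _ _ => rfl
  obtain ⟨Cl, hCl⟩ : ∃ Cl : NNReal, ∀ u v, ‖ℓ u - ℓ v‖ ≤ Cl * ‖u - v‖ := by
    refine ⟨‖LinearMap.toContinuousLinearMap ℓ‖₊, fun u v => ?_⟩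
    rw [← map_sub]
    exact (LinearMap.toContinuousLinearMap ℓ).le_opNorm (u - v)
  let F : ℝ → (((i : Fin N) → Fin (m i) → ℝ) × (Fin N → Fin n → ℝ)) →
      (((i : Fin N) → Fin (m i) → ℝ) × (Fin N → Fin n → ℝ)) := fun t X =>
    (fun i => g i t (X.1 i) (X.2 i), (fun i => h i t (X.2 i) (X.1 i)) + ℓ X.2)
  have hFL : ∀ t, LipschitzWith (⟨L, hL⟩ + Cl) (F t) := by
    intro t
    refine LipschitzWith.of_dist_le_mul fun X Y => ?_
    rw [dist_eq_norm, dist_eq_norm]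
    have hcl : ((⟨L, hL⟩ + Cl : NNReal) : ℝ) = L + Cl := rfl
    rw [hcl]
    have hCl0 : (0:ℝ) ≤ Cl := Cl.2
    have b1 : ∀ i, ‖X.1 i - Y.1 i‖ ≤ ‖X - Y‖ := fun i =>
      (norm_le_pi_norm (X.1 - Y.1) i).trans (norm_fst_le (X - Y))
    have b2 : ∀ i, ‖X.2 i - Y.2 i‖ ≤ ‖X - Y‖ := fun i =>
      (norm_le_pi_norm (X.2 - Y.2) i).trans (norm_snd_le (X - Y))
    have b3 : ‖X.2 - Y.2‖ ≤ ‖X - Y‖ := norm_snd_le (X - Y)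
    have hn := norm_nonneg (X - Y)
    rw [Prod.norm_def]
    refine max_le ?_ ?_
    · rw [pi_norm_le_iff_of_nonneg (by positivity)]
      intro i
      refine (hgl i t _ _ _ _).trans ?_
      calc L * max ‖X.1 i - Y.1 i‖ ‖X.2 i - Y.2 i‖ ≤ L * ‖X - Y‖ := by
            gcongr; exact max_le (b1 i) (b2 i)
        _ ≤ _ := by gcongr; linarith
    · have e : (F t X - F t Y).2 = ((fun i => h i t (X.2 i) (X.1 i)) - fun i => h i t (Y.2 i) (Y.1 i))
          + (ℓ X.2 - ℓ Y.2) := by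
        simp only [F, Prod.snd_sub]; abel
      rw [e]
      refine (norm_add_le _ _).trans ?_
      rw [add_mul]
      refine add_le_add ?_ ((hCl _ _).trans (by gcongr))
      rw [pi_norm_le_iff_of_nonneg (by positivity)]
      intro i
      refine (hhl i t _ _ _ _).trans ?_
      gcongr
      exact max_le (b2 i) (b1 i)
  have hFc : ∀ X, Continuous (fun t => F t X) := by
    intro X
    refine Continuous.prodMk (continuous_pi fun i => ?_) (Continuous.add (continuous_pi fun i => ?_) continuous_const)
    · exact (hgc i).comp (continuous_id.prodMk (continuous_const (y := (X.1 i, X.2 i))))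
    · exact (hhc i).comp (continuous_id.prodMk (continuous_const (y := (X.2 i, X.1 i))))
  obtain ⟨X, hX0, hX⟩ := global_exists F _ hFL hFc t₀ (z₀, y₀)
  refine ⟨fun i t => (X t).1 i, fun i t => (X t).2 i, fun i => by simp [hX0], fun i => by simp [hX0], ?_⟩
  intro i t ht
  have h1 := hX t ht
  have h2 : HasDerivAt (fun t => (X t).1) (F t (X t)).1 t :=
    (ContinuousLinearMap.fst ℝ ((i : Fin N) → Fin (m i) → ℝ) (Fin N → Fin n → ℝ)).hasFDerivAt.comp_hasDerivAt t h1
  have h3 : HasDerivAt (fun t => (X t).2) (F t (X t)).2 t :=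
    (ContinuousLinearMap.snd ℝ ((i : Fin N) → Fin (m i) → ℝ) (Fin N → Fin n → ℝ)).hasFDerivAt.comp_hasDerivAt t h1
  refine ⟨hasDerivAt_pi.1 h2 i, ?_⟩
  have := hasDerivAt_pi.1 h3 i
  simp only [F, Pi.add_apply, hℓ] at this
  exact this

lemma blend_pert {N n : ℕ} (hN : 2 ≤ N) (m : Fin N → ℕ)
    (g : (i : Fin N) → ℝ → (Fin (m i) → ℝ) → (Fin n → ℝ) → Fin (m i) → ℝ)
    (h : (i : Fin N) → ℝ → (Fin n → ℝ) → (Fin (m i) → ℝ) → Fin n → ℝ)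
    (L : ℝ) (hL : 0 ≤ L)
    (hgl : ∀ i t p q p' q', ‖g i t p q - g i t p' q'‖ ≤ L * max ‖p - p'‖ ‖q - q'‖)
    (hhl : ∀ i t p q p' q', ‖h i t p q - h i t p' q'‖ ≤ L * max ‖p - p'‖ ‖q - q'‖)
    (t : ℝ) (z : (i : Fin N) → Fin (m i) → ℝ) (y : Fin N → Fin n → ℝ) (s : Fin n → ℝ)
    (x : ((Σ i : Fin N, Fin (m i)) ⊕ Fin n) → ℝ) (E : ℝ) (hE : ∀ i, ‖y i - s‖ ≤ E) :
    ‖Sum.elim (fun q : Σ i : Fin N, Fin (m i) => g q.1 t (z q.1) (y q.1) q.2)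
      ((N : ℝ)⁻¹ • ∑ i, h i t (y i) (z i)) - blendField g h t x‖
      ≤ L * ‖Sum.elim (fun q : Σ i : Fin N, Fin (m i) => z q.1 q.2) s - x‖ + L * E := by
  set P := ‖Sum.elim (fun q : Σ i : Fin N, Fin (m i) => z q.1 q.2) s - x‖ with hP
  have hP0 : 0 ≤ P := norm_nonneg _
  have hE0 : 0 ≤ E := (norm_nonneg _).trans (hE ⟨0, by omega⟩)
  have hN0 : (N:ℝ) ≠ 0 := by positivity
  have b1 : ∀ i, ‖z i - fun b => x (Sum.inl ⟨i, b⟩)‖ ≤ P + E := by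
    intro i
    rw [pi_norm_le_iff_of_nonneg (by positivity)]
    intro b
    refine le_trans ?_ (le_add_of_nonneg_right hE0)
    exact norm_le_pi_norm (Sum.elim (fun q : Σ i : Fin N, Fin (m i) => z q.1 q.2) s - x) (Sum.inl ⟨i, b⟩)
  have b2 : ‖s - fun j => x (Sum.inr j)‖ ≤ P := by
    rw [pi_norm_le_iff_of_nonneg (by positivity)]
    intro b
    exact norm_le_pi_norm (Sum.elim (fun q : Σ i : Fin N, Fin (m i) => z q.1 q.2) s - x) (Sum.inr b)
  have b3 : ∀ i, ‖y i - fun j => x (Sum.inr j)‖ ≤ P + E := by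
    intro i
    refine (norm_sub_le_norm_sub_add_norm_sub (y i) s _).trans ?_
    linarith [hE i]
  rw [← mul_add, pi_norm_le_iff_of_nonneg (by positivity)]
  rintro (⟨i, b⟩ | j)
  · have := (hgl i t (z i) (y i) (fun b => x (Sum.inl ⟨i, b⟩)) (fun j => x (Sum.inr j))).trans
      (mul_le_mul_of_nonneg_left (max_le (b1 i) (b3 i)) hL)
    exact (norm_le_pi_norm (g i t (z i) (y i) - g i t (fun b => x (Sum.inl ⟨i, b⟩)) (fun j => x (Sum.inr j))) b).trans this
  · have h1 : ∀ i, ‖h i t (y i) (z i) - h i t (fun j => x (Sum.inr j)) (fun b => x (Sum.inl ⟨i, b⟩))‖ ≤ L * (P + E) :=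
      fun i => (hhl i t (y i) (z i) (fun j => x (Sum.inr j)) (fun b => x (Sum.inl ⟨i, b⟩))).trans
      (mul_le_mul_of_nonneg_left (max_le (b3 i) (b1 i)) hL)
    have h2 : ‖(N : ℝ)⁻¹ • ∑ i, h i t (y i) (z i) -
        (N : ℝ)⁻¹ • ∑ i, h i t (fun j => x (Sum.inr j)) (fun b => x (Sum.inl ⟨i, b⟩))‖ ≤ L * (P + E) := by
      rw [← smul_sub, ← Finset.sum_sub_distrib, norm_smul, norm_inv, Real.norm_natCast]
      have : ‖∑ i, (h i t (y i) (z i) - h i t (fun j => x (Sum.inr j)) (fun b => x (Sum.inl ⟨i, b⟩)))‖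
        ≤ ∑ _i : Fin N, L * (P + E) := norm_sum_le_of_le _ fun i _ => h1 i
      simp only [Finset.sum_const, Finset.card_univ, Fintype.card_fin, nsmul_eq_mul] at this
      calc (N:ℝ)⁻¹ * _ ≤ (N:ℝ)⁻¹ * (N * (L * (P + E))) := by gcongr
        _ = L * (P + E) := by field_simp
    exact (norm_le_pi_norm _ j).trans h2

lemma compact_k {X : Type*} [TopologicalSpace X] {K : Set X} (hK : IsCompact K) (P : ℝ → X → Prop)
    (hloc : ∀ x ∈ K, ∃ U ∈ nhds x, ∃ kstar > (0:ℝ), ∀ k > kstar, ∀ x₀ ∈ U, P k x₀) :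
    ∃ kstar > (0:ℝ), ∀ k > kstar, ∀ x₀ ∈ K, P k x₀ := by
  refine hK.induction_on (p := fun S => ∃ kstar > (0:ℝ), ∀ k > kstar, ∀ x₀ ∈ S, P k x₀) ?_ ?_ ?_ ?_
  · exact ⟨1, one_pos, by simp⟩
  · rintro s t hst ⟨k, hk, h⟩
    exact ⟨k, hk, fun k hk x hx => h k hk x (hst hx)⟩
  · rintro s t ⟨k, hk, h⟩ ⟨k', hk', h'⟩
    refine ⟨max k k', lt_max_of_lt_left hk, fun κ hκ x hx => ?_⟩
    rcases hx with hx | hx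
    · exact h κ (lt_of_le_of_lt (le_max_left _ _) hκ) x hx
    · exact h' κ (lt_of_le_of_lt (le_max_right _ _) hκ) x hx
  · intro x hx
    obtain ⟨U, hU, h⟩ := hloc x hx
    exact ⟨U, mem_nhdsWithin_of_mem_nhds hU, h⟩

set_option maxHeartbeats 4000000 in
theorem stmt4
    {N n : ℕ} (hN : 2 ≤ N) (m : Fin N → ℕ) (t₀ : ℝ)
    (α : Fin N → Fin N → ℝ)
    (hsym : ∀ i j, α i j = α j i) (hnn : ∀ i j, 0 ≤ α i j) (hdiag : ∀ i, α i i = 0)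
    (hpsd : (lapMat α).PosSemidef)
    (hconn : LinearMap.ker (lapMat α).mulVecLin
      = Submodule.span ℝ {(fun _ => 1 : Fin N → ℝ)})
    (Λ : Matrix (Fin n) (Fin n) ℝ) (hΛ : Λ.IsSymm ∧ Λ.PosDef)
    (g : (i : Fin N) → ℝ → (Fin (m i) → ℝ) → (Fin n → ℝ) → Fin (m i) → ℝ)
    (h : (i : Fin N) → ℝ → (Fin n → ℝ) → (Fin (m i) → ℝ) → Fin n → ℝ)
    (hgreg : ∀ i, Reg2 (g i)) (hhreg : ∀ i, Reg2 (h i))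
    (Ab Db : Set (((Σ i : Fin N, Fin (m i)) ⊕ Fin n) → ℝ))
    (hAb : Ab.Nonempty) (hAbc : IsCompact Ab) (hDb : IsOpen Db) (hAD : Ab ⊆ Db)
    (hUAS : UAS (blendField g h) Ab Db)
    (Ax : Set ((Σ i : Fin N, Fin (m i) ⊕ Fin n) → ℝ))
    (hAx : Ax = {X | ∃ p ∈ Ab, ∀ q : Σ i : Fin N, Fin (m i) ⊕ Fin n,
      X q = Sum.elim (fun b => p (Sum.inl ⟨q.1, b⟩)) (fun j => p (Sum.inr j)) q.2})
    (Dx : Set ((Σ i : Fin N, Fin (m i) ⊕ Fin n) → ℝ))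
    (hDx : Dx = {X | ∃ s : Fin n → ℝ,
      Sum.elim (fun r : Σ i : Fin N, Fin (m i) => X ⟨r.1, Sum.inl r.2⟩) s ∈ Db ∧
      (N : ℝ)⁻¹ • (∑ i, (fun j => X ⟨i, Sum.inr j⟩ : Fin n → ℝ)) = s})
    (K : Set ((Σ i : Fin N, Fin (m i) ⊕ Fin n) → ℝ)) (hK : IsCompact K) (hKD : K ⊆ Dx)
    (η : ℝ) (hη : 0 < η) :
    ∃ kstar > (0:ℝ), ∀ k > kstar, ∀ X₀ ∈ K,
      ∃ (z : (i : Fin N) → ℝ → Fin (m i) → ℝ) (y : Fin N → ℝ → Fin n → ℝ),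
        (∀ i, (∀ b, z i t₀ b = X₀ ⟨i, Sum.inl b⟩) ∧ (∀ j, y i t₀ j = X₀ ⟨i, Sum.inr j⟩)) ∧
        (∀ i, ∀ t ≥ t₀,
          HasDerivAt (z i) (g i t (z i t) (y i t)) t ∧
          HasDerivAt (y i)
            (h i t (y i t) (z i t) + k • Λ.mulVec (∑ j, α i j • (y j t - y i t))) t) ∧
        LimsupLE (fun t => einfDist
          (fun q : Σ i : Fin N, Fin (m i) ⊕ Fin n => Sum.elim (z q.1 t) (y q.1 t) q.2) Ax) η := by
  have hN0 : (N:ℝ) ≠ 0 := by positivity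
  obtain ⟨lam, hlam, gap⟩ := lap_gap hN α hsym hnn hconn Λ hΛ.2
  obtain ⟨hstab, hattr⟩ := UAS_norm hAb hUAS
  refine compact_k hK _ fun X hX => ?_
  set sav : ((Σ i : Fin N, Fin (m i) ⊕ Fin n) → ℝ) → Fin n → ℝ := fun X =>
    (N : ℝ)⁻¹ • (∑ i, (fun j => X ⟨i, Sum.inr j⟩ : Fin n → ℝ)) with hsav
  set P : ((Σ i : Fin N, Fin (m i) ⊕ Fin n) → ℝ) → ((Σ i : Fin N, Fin (m i)) ⊕ Fin n) → ℝ := fun X =>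
    Sum.elim (fun r : Σ i : Fin N, Fin (m i) => X ⟨r.1, Sum.inl r.2⟩) (sav X) with hP
  set V : ((Σ i : Fin N, Fin (m i) ⊕ Fin n) → ℝ) → ℝ := fun X =>
    ∑ i, ∑ l, (X ⟨i, Sum.inr l⟩ - sav X l) ^ 2 with hV
  have hsavc : Continuous sav := by
    simp only [hsav]; fun_prop
  have hPc : Continuous P := by
    refine continuous_pi fun q => ?_
    rcases q with q | j
    · exact continuous_apply _
    · exact (continuous_apply j).comp hsavc
  have hVc : Continuous V := by
    refine continuous_finset_sum _ fun i _ => continuous_finset_sum _ fun l _ => ?_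
    have h2 : Continuous fun X => sav X l := (continuous_pi_iff.1 hsavc) l
    exact ((continuous_apply _).sub h2).pow 2
  have hV0 : 0 ≤ V X := Finset.sum_nonneg fun i _ => Finset.sum_nonneg fun l _ => sq_nonneg _
  have hp0 : P X ∈ Db := by
    have := hKD hX
    rw [hDx] at this
    obtain ⟨s, h1, h2⟩ := this
    rw [← h2] at h1
    exact h1
  obtain ⟨ε₀, hε₀, hthick⟩ := hAbc.exists_cthickening_subset_open hDb hAD
  have hthc : IsCompact (Metric.cthickening ε₀ Ab) := hAbc.cthickening
  set C := insert (P X) (Metric.cthickening ε₀ Ab) with hCdef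
  have hCc : IsCompact C := hthc.insert _
  have hCD : C ⊆ Db := Set.insert_subset hp0 hthick
  set cd : ℝ := (Fintype.card (Σ i : Fin N, Fin (m i) ⊕ Fin n) : ℝ) + 1 with hcd
  have hcd0 : 0 < cd := by positivity
  obtain ⟨ε, hε, hεε₀, hεη⟩ : ∃ ε > 0, ε ≤ ε₀ ∧ cd * (2 * ε) ≤ η := by
    refine ⟨min ε₀ (η / (2 * cd)), by positivity, min_le_left _ _, ?_⟩
    calc cd * (2 * min ε₀ (η / (2 * cd))) ≤ cd * (2 * (η / (2 * cd))) := by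
          gcongr; exact min_le_right _ _
      _ = η := by field_simp
  obtain ⟨δ', hδ', hst⟩ := hstab (ε / 2) (by positivity)
  obtain ⟨δ, hδ, hδδ', hδε₀⟩ : ∃ δ > 0, δ ≤ δ' ∧ δ ≤ ε₀ :=
    ⟨min δ' ε₀, by positivity, min_le_left _ _, min_le_right _ _⟩
  obtain ⟨hE, hAt⟩ := hattr C hCc hCD
  obtain ⟨T, hT, hAt⟩ := hAt (δ / 2) (by positivity)
  obtain ⟨x0, hx00, hx0⟩ := hE t₀ (P X) (Set.mem_insert _ _)
  obtain ⟨R1, hR1⟩ := (isCompact_Icc (a := t₀) (b := t₀ + T)).exists_bound_of_continuousOn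
    (f := x0) (fun s hs => (hx0 s hs.1).continuousAt.continuousWithinAt)
  have hR10 : 0 ≤ R1 := (norm_nonneg _).trans (hR1 t₀ ⟨le_rfl, by linarith⟩)
  obtain ⟨R2, hR2⟩ := hthc.isBounded.exists_norm_le
  have hmem : ∀ r ≤ ε₀, ∀ x, (∃ a ∈ Ab, ‖x - a‖ < r) → x ∈ Metric.cthickening ε₀ Ab := by
    rintro r hr x ⟨a, ha, hxa⟩
    exact Metric.mem_cthickening_of_dist_le x a ε₀ Ab ha (by rw [dist_eq_norm]; linarith)
  set a := Real.sqrt (V X + 1) with ha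
  have ha0 : 0 ≤ a := Real.sqrt_nonneg _
  have ha2 : a ^ 2 = V X + 1 := Real.sq_sqrt (by linarith)
  set Rp := max R1 R2 + 1 with hRp
  have hRp1 : R1 + 1 ≤ Rp := by linarith [le_max_left R1 R2]
  have hRp2 : R2 ≤ Rp := by linarith [le_max_right R1 R2]
  set R := Rp + a + 1 with hR
  have hR0 : 0 ≤ R := by linarith
  choose g' Lg hLg hgc hgl hgb hgeq using fun i => reg2_clamp (hgreg i) hR0
  choose h' Lh hLh hhc hhl hhb hheq using fun i => reg2_clamp (hhreg i) hR0
  obtain ⟨L, hL, hLgL, hLhL⟩ : ∃ L ≥ (0:ℝ), (∀ i, Lg i ≤ L) ∧ (∀ i, Lh i ≤ L) := by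
    refine ⟨∑ i, Lg i + ∑ i, Lh i, add_nonneg (Finset.sum_nonneg fun i _ => hLg i)
      (Finset.sum_nonneg fun i _ => hLh i), fun i => ?_, fun i => ?_⟩
    · have h1 := Finset.single_le_sum (f := Lg) (fun i _ => hLg i) (Finset.mem_univ i)
      have h2 := Finset.sum_nonneg (f := Lh) (s := Finset.univ) (fun i _ => hLh i)
      linarith
    · have h1 := Finset.single_le_sum (f := Lh) (fun i _ => hLh i) (Finset.mem_univ i)
      have h2 := Finset.sum_nonneg (f := Lg) (s := Finset.univ) (fun i _ => hLg i)
      linarith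
  have hgl' : ∀ i t p q p' q', ‖g' i t p q - g' i t p' q'‖ ≤ L * max ‖p - p'‖ ‖q - q'‖ := by
    intro i t p q p' q'
    refine (hgl i t p q p' q').trans ?_
    gcongr
    exact hLgL i
  have hhl' : ∀ i t p q p' q', ‖h' i t p q - h' i t p' q'‖ ≤ L * max ‖p - p'‖ ‖q - q'‖ := by
    intro i t p q p' q'
    refine (hhl i t p q p' q').trans ?_
    gcongr
    exact hLhL i
  have hhb' : ∀ i t p q, ‖h' i t p q‖ ≤ L := fun i t p q => (hhb i t p q).trans (hLhL i)
  have hblend : ∀ t x, ‖x‖ ≤ R → blendField g h t x = blendField g' h' t x := by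
    intro t x hx
    have b1 : ∀ i, ‖fun b => x (Sum.inl ⟨i, b⟩)‖ ≤ R := fun i => by
      rw [pi_norm_le_iff_of_nonneg hR0]
      exact fun b => (norm_le_pi_norm x _).trans hx
    have b2 : ‖fun j => x (Sum.inr j)‖ ≤ R := by
      rw [pi_norm_le_iff_of_nonneg hR0]
      exact fun b => (norm_le_pi_norm x _).trans hx
    simp only [blendField]
    congr 1
    · funext q
      rw [hgeq q.1 t _ _ (b1 _) b2]
    · funext j
      simp only [fun i => hheq i t _ _ b2 (b1 i)]
  set c₀ := 2 * L * (N * n + 1) / lam with hc₀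
  have hc₀0 : 0 ≤ c₀ := by positivity
  set ω₀ := 2 * L * a / lam + 2 * (L * c₀ + 1) * T with hω₀
  have hω₀0 : 0 ≤ ω₀ := by positivity
  obtain ⟨mm, hmm, hmmδ, hmm1, hmmε⟩ : ∃ mm > (0:ℝ), mm ≤ δ / 4 ∧ mm ≤ 1 / 2 ∧ mm ≤ ε / 2 := by
    refine ⟨min (min (δ / 4) (1 / 2)) (ε / 2), by positivity, ?_, ?_, min_le_right _ _⟩
    · exact (min_le_left _ _).trans (min_le_left _ _)
    · exact (min_le_left _ _).trans (min_le_right _ _)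
  set a₁ := 2 * a / (lam * T) with ha₁
  have ha₁0 : 0 ≤ a₁ := by positivity
  set ω₁ := ω₀ * Real.exp (L * T) with hω₁
  have hω₁0 : 0 ≤ ω₁ := by positivity
  set r := mm * Real.exp (-(L * T)) with hr
  have hr0 : 0 < r := by positivity
  refine ⟨{X₀ | ‖P X₀ - P X‖ < r ∧ V X₀ < V X + 1}, ?_, (c₀ + a₁ + ω₁) / mm + 1, by positivity, ?_⟩
  · refine IsOpen.mem_nhds ?_ ?_
    · exact (isOpen_lt (hPc.sub continuous_const).norm continuous_const).inter
        (isOpen_lt hVc continuous_const)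
    · simp [hr0]
  rintro k hk X₀ ⟨hX₀P, hX₀V⟩
  have hk0 : 0 < k := lt_trans (by positivity) hk
  have hWk : (c₀ + a₁ + ω₁) ≤ mm * k := by
    have : (c₀ + a₁ + ω₁) / mm ≤ k := by linarith
    rw [div_le_iff₀ hmm] at this
    linarith
  have hk1 : c₀ / k ≤ mm := by rw [div_le_iff₀ hk0]; linarith
  have hk2 : a₁ / k ≤ mm := by rw [div_le_iff₀ hk0]; linarith
  have hk3 : ω₁ / k ≤ mm := by rw [div_le_iff₀ hk0]; linarith
  obtain ⟨z, y, hz0, hy0, hzy⟩ := net_exists m t₀ α Λ g' h' L hL hgc hhc hgl' hhl' k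
    (fun i b => X₀ ⟨i, Sum.inl b⟩) (fun i j => X₀ ⟨i, Sum.inr j⟩)
  set s : ℝ → Fin n → ℝ := fun t => (N : ℝ)⁻¹ • ∑ i, y i t with hs
  have hst0 : s t₀ = sav X₀ := by
    simp only [hs, hsav, hy0]
  obtain ⟨hsd, hdec⟩ := sync_decay hN α hsym Λ lam hlam gap k L t₀ a hk0 hL ha0 y
    (fun i t => h' i t (y i t) (z i t)) s (fun t => rfl) (fun i t ht => (hzy i t ht).2)
    (fun i t => hhb' i t _ _) (by
      rw [hst0, ha2]
      simp only [hy0]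
      exact hX₀V.le)
  set p : ℝ → ((Σ i : Fin N, Fin (m i)) ⊕ Fin n) → ℝ := fun t =>
    Sum.elim (fun q : Σ i : Fin N, Fin (m i) => z q.1 t q.2) (s t) with hp
  have hpd : ∀ t ≥ t₀, HasDerivAt p (Sum.elim
      (fun q : Σ i : Fin N, Fin (m i) => g' q.1 t (z q.1 t) (y q.1 t) q.2)
      ((N : ℝ)⁻¹ • ∑ i, h' i t (y i t) (z i t))) t := by
    intro t ht
    rw [hasDerivAt_pi]
    rintro (q | j)
    · exact hasDerivAt_pi.1 (hzy q.1 t ht).1 q.2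
    · exact hasDerivAt_pi.1 (hsd t ht) j
  have hpt0 : p t₀ = P X₀ := by
    simp only [hp, hP, hst0, hz0]
  have hclose : ∀ s₁ ≥ t₀, ∀ x, IsSolOn (blendField g h) x s₁ →
      (∀ t ∈ Set.Icc s₁ (s₁ + T), ‖x t‖ ≤ Rp) →
      ∀ t ∈ Set.Icc s₁ (s₁ + T), ‖p t - x t‖ ≤ ‖p s₁ - x s₁‖ * Real.exp (L * T) + mm := by
    intro s₁ hs₁ x hx hxR t ht
    have hb : 0 < k * lam / 2 := by positivity
    have hcp : 0 < (L * c₀ + 1) / k := by positivity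
    have := pert_gronwall (fun t => p t - x t) _ s₁ T L (L * a) (k * lam / 2) ((L * c₀ + 1) / k)
      hL (by positivity) hb hcp
      (fun t ht => (hpd t (hs₁.le.trans ht.1)).sub (hx t ht.1)) (by
        intro t ht
        rw [hblend t (x t) ((hxR t ht).trans (by linarith))]
        have ht0 : t₀ ≤ t := hs₁.le.trans ht.1
        refine (blend_pert hN m g' h' L hL hgl' hhl' t (fun i => z i t) (fun i => y i t) (s t) (x t)
          _ (fun i => hdec t ht0 i)).trans ?_
        have e1 : Real.exp (-(k * lam / 2) * (t - t₀)) ≤ Real.exp (-(k * lam / 2) * (t - s₁)) := by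
          rw [Real.exp_le_exp]
          have : k * lam / 2 * (t - s₁) ≤ k * lam / 2 * (t - t₀) := by gcongr
          linarith
        have e2 : L * (a * Real.exp (-(k * lam / 2) * (t - t₀))) ≤
            L * (a * Real.exp (-(k * lam / 2) * (t - s₁))) := by gcongr
        have e3 : (L * c₀ + 1) / k = L * (c₀ / k) + 1 / k := by ring
        have e4 : 0 < 1 / k := by positivity
        rw [e3]
        linarith) t ht
    refine this.trans ?_
    have e : (L * a / (k * lam / 2) + 2 * ((L * c₀ + 1) / k) * T) * Real.exp (L * T) = ω₁ / k := by
      rw [hω₁, hω₀]; field_simp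
    rw [add_assoc, add_mul, e]
    linarith
  -- first window
  have hwin : ∀ t ∈ Set.Icc t₀ (t₀ + T), ‖p t - x0 t‖ ≤ 2 * mm := by
    intro t ht
    refine (hclose t₀ le_rfl x0 hx0 (fun t ht => (hR1 t ht).trans (by linarith)) t ht).trans ?_
    rw [hpt0, hx00]
    have : ‖P X₀ - P X‖ * Real.exp (L * T) ≤ r * Real.exp (L * T) := by gcongr
    have e : r * Real.exp (L * T) = mm := by
      rw [hr, mul_assoc, ← Real.exp_add]; simp
    linarith
  have htr : ∀ t ≥ t₀ + T, ∃ a ∈ Ab, ‖p t - a‖ < ε := by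
    refine tracking (blendField g h) Ab C p t₀ (t₀ + T) T ε δ mm Rp (by linarith) hT ?_
      (by linarith) hmmε hε (fun s x hx ⟨a, ha, hxa⟩ => hst s x hx ⟨a, ha, by linarith⟩)
      hAt hE (fun x hx => Set.mem_insert_of_mem _ (hmem δ hδε₀ x hx))
      (fun x hx => (hR2 x (hmem ε hεε₀ x hx)).trans hRp2) ?_
    · intro s₁ hs₁ x hx hxs hxR t ht
      have := hclose s₁ hs₁ x hx hxR t ht
      rwa [hxs, sub_self, norm_zero, zero_mul, zero_add] at this
    · obtain ⟨b, hb, hxb⟩ := hAt t₀ x0 hx0 (by rw [hx00]; exact Set.mem_insert _ _) (t₀ + T) le_rfl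
      refine ⟨b, hb, ?_⟩
      have h1 := hwin (t₀ + T) ⟨by linarith, le_rfl⟩
      have h2 := norm_sub_le_norm_sub_add_norm_sub (p (t₀ + T)) (x0 (t₀ + T)) b
      linarith
  have hpR : ∀ t ≥ t₀, ‖p t‖ ≤ Rp := by
    intro t ht
    rcases le_total t (t₀ + T) with h1 | h1
    · have h2 := hwin t ⟨ht, h1⟩
      have h3 := hR1 t ⟨ht, h1⟩
      have h4 := norm_le_norm_sub_add (p t) (x0 t)
      linarith
    · exact (hR2 _ (hmem ε hεε₀ _ (htr t h1))).trans hRp2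
  have hzR : ∀ t ≥ t₀, ∀ i, ‖z i t‖ ≤ R := by
    intro t ht i
    rw [pi_norm_le_iff_of_nonneg hR0]
    intro b
    have := (norm_le_pi_norm (p t) (Sum.inl ⟨i, b⟩)).trans (hpR t ht)
    have h2 : ‖z i t b‖ ≤ Rp := this
    linarith
  have hyR : ∀ t ≥ t₀, ∀ i, ‖y i t‖ ≤ R := by
    intro t ht i
    have h1 : ‖s t‖ ≤ Rp := by
      rw [pi_norm_le_iff_of_nonneg (by linarith)]
      intro b
      exact (norm_le_pi_norm (p t) (Sum.inr b)).trans (hpR t ht)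
    have h2 := hdec t ht i
    have h3 : Real.exp (-(k * lam / 2) * (t - t₀)) ≤ 1 := by
      rw [Real.exp_le_one_iff]
      have : 0 ≤ k * lam / 2 * (t - t₀) := mul_nonneg (by positivity) (by linarith)
      linarith
    have h4 : a * Real.exp (-(k * lam / 2) * (t - t₀)) ≤ a * 1 := by gcongr
    have h5 := norm_le_norm_sub_add (y i t) (s t)
    linarith
  refine ⟨z, y, fun i => ⟨fun b => by rw [hz0], fun j => by rw [hy0]⟩, ?_, ?_⟩
  · intro i t ht
    have := hzy i t ht
    rwa [hgeq i t _ _ (hzR t ht i) (hyR t ht i), hheq i t _ _ (hyR t ht i) (hzR t ht i)] at this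
  · intro e he
    refine ⟨t₀ + T, fun t ht => ?_⟩
    obtain ⟨b, hb, hpb⟩ := htr t ht
    have htt : t₀ ≤ t := by linarith
    have hmemA : (fun q : Σ i : Fin N, Fin (m i) ⊕ Fin n =>
        Sum.elim (fun c => b (Sum.inl ⟨q.1, c⟩)) (fun j => b (Sum.inr j)) q.2) ∈ Ax := by
      rw [hAx]
      exact ⟨b, hb, fun q => rfl⟩
    refine (einfDist_le hmemA).trans ?_
    have hbnd : ‖(fun q : Σ i : Fin N, Fin (m i) ⊕ Fin n => Sum.elim (z q.1 t) (y q.1 t) q.2) -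
        (fun q : Σ i : Fin N, Fin (m i) ⊕ Fin n =>
        Sum.elim (fun c => b (Sum.inl ⟨q.1, c⟩)) (fun j => b (Sum.inr j)) q.2)‖ ≤ 2 * ε := by
      rw [pi_norm_le_iff_of_nonneg (by positivity)]
      rintro ⟨i, c | j⟩
      · have := norm_le_pi_norm (p t - b) (Sum.inl ⟨i, c⟩)
        have h2 : ‖z i t c - b (Sum.inl ⟨i, c⟩)‖ ≤ ‖p t - b‖ := this
        show ‖z i t c - b (Sum.inl ⟨i, c⟩)‖ ≤ 2 * ε
        linarith
      · have h1 : ‖s t j - b (Sum.inr j)‖ ≤ ‖p t - b‖ := norm_le_pi_norm (p t - b) (Sum.inr j)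
        have h2 : ‖y i t j - s t j‖ ≤ ‖y i t - s t‖ := norm_le_pi_norm (y i t - s t) j
        have h3 := hdec t htt i
        have h4 := norm_sub_le_norm_sub_add_norm_sub (y i t j) (s t j) (b (Sum.inr j))
        have hu : 0 < k * lam / 2 * T := by positivity
        have h5 : Real.exp (-(k * lam / 2) * (t - t₀)) ≤ (k * lam / 2 * T)⁻¹ := by
          have e1 : Real.exp (-(k * lam / 2) * (t - t₀)) ≤ Real.exp (-(k * lam / 2 * T)) := by
            rw [Real.exp_le_exp]
            have : k * lam / 2 * T ≤ k * lam / 2 * (t - t₀) := by gcongr; linarith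
            linarith
          refine e1.trans ?_
          rw [Real.exp_neg]
          gcongr
          linarith [Real.add_one_le_exp (k * lam / 2 * T)]
        have h6 : a * Real.exp (-(k * lam / 2) * (t - t₀)) ≤ a₁ / k := by
          calc _ ≤ a * (k * lam / 2 * T)⁻¹ := by gcongr
            _ = a₁ / k := by rw [ha₁]; field_simp
        show ‖y i t j - b (Sum.inr j)‖ ≤ 2 * ε
        linarith
    calc _ ≤ cd * (2 * ε) := by
          rw [hcd]; gcongr
      _ ≤ η + e := by linarith
end

section
/- Let 𝓛 ∈ ℝ^{N×N} be the Laplacian of an undirected connected weighted graph on N ≥ 2 vertices (symmetric positive semidefinite with ker 𝓛 = span{1_N}), and let λ₂ > 0 be its second smallest eigenvalue (the smallest eigenvalue of 𝓛 restricted to the orthogonal complement of 1_N). Then for every x ∈ ℝ^N and η ≥ 0 such that |(𝓛x)_i| ≤ η for all i ∈ {1,…,N}, it holds that |x_i − x_j| ≤ (2·√N/λ₂)·η for all i, j ∈ {1,…,N}. -/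
open Matrix

theorem stmt15
    {N : ℕ} (hN : 2 ≤ N)
    (L : Matrix (Fin N) (Fin N) ℝ)
    (hLsym : L.IsSymm) (hpsd : L.PosSemidef)
    (hker : LinearMap.ker L.mulVecLin = Submodule.span ℝ {(fun _ => 1 : Fin N → ℝ)})
    (lam2 : ℝ) (hlam2pos : 0 < lam2)
    (hlam2min : ∀ y : Fin N → ℝ, (∑ i, y i) = 0 →
      lam2 * ∑ i, y i ^ 2 ≤ ∑ i, y i * L.mulVec y i)
    (hlam2att : ∃ y : Fin N → ℝ, (∑ i, y i) = 0 ∧ y ≠ 0 ∧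
      lam2 * ∑ i, y i ^ 2 = ∑ i, y i * L.mulVec y i) :
    ∀ (x : Fin N → ℝ) (η : ℝ), 0 ≤ η → (∀ i, |L.mulVec x i| ≤ η) →
      ∀ i j, |x i - x j| ≤ 2 * Real.sqrt N / lam2 * η := by
  intro x η hη hx i j
  have hNpos : (0 : ℝ) < N := by exact_mod_cast (by omega : 0 < N)
  obtain ⟨c, hc⟩ : ∃ c : ℝ, c = (∑ k, x k) / N := ⟨_, rfl⟩
  obtain ⟨y, hy⟩ : ∃ y : Fin N → ℝ, y = x - c • (fun _ => (1 : ℝ)) := ⟨_, rfl⟩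
  have hyk : ∀ k, y k = x k - c := by intro k; simp [hy]
  have hone : L.mulVec (fun _ => (1 : ℝ)) = 0 := by
    have h : (fun _ => 1 : Fin N → ℝ) ∈ LinearMap.ker L.mulVecLin := by
      rw [hker]; exact Submodule.mem_span_singleton_self _
    simpa using h
  have hLy : L.mulVec y = L.mulVec x := by
    rw [hy, Matrix.mulVec_sub, Matrix.mulVec_smul, hone]; simp
  have hsum : ∑ k, y k = 0 := by
    simp only [hyk, Finset.sum_sub_distrib, Finset.sum_const, Finset.card_univ,
      Fintype.card_fin, nsmul_eq_mul]
    rw [hc]; field_simp; ring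
  have h1 := hlam2min y hsum
  rw [hLy] at h1
  have hCS := Finset.sum_mul_sq_le_sq_mul_sq Finset.univ y (L.mulVec x)
  have hb : ∑ k, (L.mulVec x k) ^ 2 ≤ N * η ^ 2 := by
    calc ∑ k, (L.mulVec x k) ^ 2 ≤ ∑ _k : Fin N, η ^ 2 :=
          Finset.sum_le_sum fun k _ => sq_le_sq' (abs_le.mp (hx k)).1 (abs_le.mp (hx k)).2
      _ = N * η ^ 2 := by simp
  have hS0 : 0 ≤ ∑ k, y k ^ 2 := Finset.sum_nonneg fun k _ => sq_nonneg _
  have hle : ∀ k, y k ^ 2 ≤ ∑ k, y k ^ 2 := fun k =>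
    Finset.single_le_sum (f := fun k => y k ^ 2) (fun k _ => sq_nonneg _) (Finset.mem_univ k)
  generalize (∑ k, y k ^ 2) = S at *
  have h2 : (lam2 * S) ^ 2 ≤ S * (N * η ^ 2) :=
    (pow_le_pow_left₀ (by positivity) h1 2).trans
      (hCS.trans (mul_le_mul_of_nonneg_left hb hS0))
  have h3 : lam2 ^ 2 * S ≤ N * η ^ 2 := by
    rcases hS0.eq_or_lt with h | h
    · rw [← h]; simp; positivity
    · exact le_of_mul_le_mul_left (by linarith [h2, mul_pow lam2 S 2, (by ring : S * (lam2 ^ 2 * S) = (lam2 * S) ^ 2)]) h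
  have h4 : ∀ k, |y k| ≤ Real.sqrt N / lam2 * η := by
    intro k
    apply abs_le_of_sq_le_sq _ (by positivity)
    rw [div_mul_eq_mul_div, div_pow, mul_pow, Real.sq_sqrt hNpos.le, le_div_iff₀ (by positivity)]
    nlinarith [mul_le_mul_of_nonneg_left (hle k) (sq_nonneg lam2)]
  have h5 : x i - x j = y i - y j := by rw [hyk, hyk]; ring
  rw [h5]
  calc |y i - y j| ≤ |y i| + |y j| := abs_sub _ _
    _ ≤ Real.sqrt N / lam2 * η + Real.sqrt N / lam2 * η := add_le_add (h4 i) (h4 j)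
    _ = _ := by ring
end
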